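/- The lattices Γ_τ and Γ_φ are both even (all pairings of their elements are integers and all self-pairings are even integers), and they are isometric: there exists a ℤ-linear bijection F : Γ_τ → Γ_φ such that ⟨F(u),F(v)⟩ = ⟨u,v⟩ for all u,v ∈ Γ_τ. -/

import Mathlib

/- Context: V = ℚ^12 with coordinates (e₁,e₂,e₃,e₄,n₁,…,n₈) (indices 0,…,11),
Gram matrix D₄(2) ⊕ ⟨-2⟩^8, and the lattices Γ_τ, Γ_φ of the paper. -/

noncomputable section
open Matrix

abbrev V : Type := Fin 12 → ℚ

/-- Gram matrix: D₄(2) = [[-4,0,2,0],[0,-4,2,0],[2,2,-4,2],[0,0,2,-4]] on the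
first four coordinates, -2·Id on the last eight. -/
def gramG : Matrix (Fin 12) (Fin 12) ℚ := Matrix.of fun i j =>
  if i.val < 4 ∧ j.val < 4 then
    (if i = j then -4 else if i.val = 2 ∨ j.val = 2 then 2 else 0)
  else if i = j then -2 else 0

def B (u v : V) : ℚ := u ⬝ᵥ (gramG *ᵥ v)

def bv : Fin 12 → V := fun i j => if i = j then 1 else 0

/-- ν = (n₁+⋯+n₈)/2 -/
def ν : V := (1/2 : ℚ) • (bv 4 + bv 5 + bv 6 + bv 7 + bv 8 + bv 9 + bv 10 + bv 11)
/-- x₁ = (e₄-e₂+n₂+n₄+n₅+n₆)/2 -/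
def x₁ : V := (1/2 : ℚ) • (bv 3 - bv 1 + bv 5 + bv 7 + bv 8 + bv 9)
/-- x₂ = (e₁-e₂+n₂+n₃+n₅+n₇)/2 -/
def x₂ : V := (1/2 : ℚ) • (bv 0 - bv 1 + bv 5 + bv 6 + bv 8 + bv 10)
/-- x'₁ = (e₂-e₁+n₂+n₃+n₄+n₈)/2 -/
def x'₁ : V := (1/2 : ℚ) • (bv 1 - bv 0 + bv 5 + bv 6 + bv 7 + bv 11)
/-- x'₂ = (e₂+e₄+n₃+n₆+n₇+n₈)/2 -/
def x'₂ : V := (1/2 : ℚ) • (bv 1 + bv 3 + bv 6 + bv 9 + bv 10 + bv 11)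

def Γτ : Submodule ℤ V := Submodule.span ℤ (Set.range bv ∪ {ν, x₁, x₂})

def Γφ : Submodule ℤ V := Submodule.span ℤ (Set.range bv ∪ {ν, x'₁, x'₂})

theorem B_add_left (u v w : V) : B (u + v) w = B u w + B v w := by
  simp [B, add_dotProduct]

theorem B_smul_left (n : ℤ) (u w : V) : B (n • u) w = n * B u w := by
  rw [B, smul_dotProduct, zsmul_eq_mul, B]

theorem B_apply (u v : V) : B u v =
    -4 * (u 0 * v 0 + u 1 * v 1 + u 2 * v 2 + u 3 * v 3)
    + 2 * (u 0 * v 2 + u 2 * v 0 + u 1 * v 2 + u 2 * v 1 + u 3 * v 2 + u 2 * v 3)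
    - 2 * (u 4 * v 4 + u 5 * v 5 + u 6 * v 6 + u 7 * v 7
      + u 8 * v 8 + u 9 * v 9 + u 10 * v 10 + u 11 * v 11) := by
  simp [B, gramG, dotProduct, mulVec, Fin.sum_univ_succ]
  ring

theorem B_comm (u v : V) : B u v = B v u := by
  rw [B_apply, B_apply]
  ring

theorem B_bv_left (i : Fin 12) (v : V) : B (bv i) v = (gramG *ᵥ v) i := by
  have h : bv i = Pi.single i 1 := by
    ext j
    simp [bv, Pi.single_apply, eq_comm]
  simp [B, h]

theorem exists_int_B_of_mem_span {S : Set V}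
    (h : ∀ u ∈ S, ∀ v ∈ S, ∃ n : ℤ, B u v = n) :
    ∀ u ∈ Submodule.span ℤ S, ∀ v ∈ Submodule.span ℤ S, ∃ n : ℤ, B u v = n := by
  have extend (w : V) (hw : ∀ u ∈ S, ∃ n : ℤ, B u w = n) :
      ∀ u ∈ Submodule.span ℤ S, ∃ n : ℤ, B u w = n := by
    intro u hu
    induction hu using Submodule.span_induction with
    | mem x hx => exact hw x hx
    | zero => exact ⟨0, by simp [B]⟩
    | add x y _ _ hx hy =>
      obtain ⟨a, ha⟩ := hx
      obtain ⟨b, hb⟩ := hy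
      exact ⟨a + b, by rw [B_add_left, ha, hb]; push_cast; rfl⟩
    | smul n x _ hx =>
      obtain ⟨a, ha⟩ := hx
      exact ⟨n * a, by rw [B_smul_left, ha]; push_cast; rfl⟩
  intro u hu v hv
  refine extend v (fun w hw => ?_) u hu
  rw [B_comm]
  exact extend w (fun x hx => h x hx w hw) v hv

theorem exists_even_B_self_of_mem_span {S : Set V}
    (h : ∀ u ∈ S, ∀ v ∈ S, ∃ n : ℤ, B u v = n) (h' : ∀ u ∈ S, ∃ n : ℤ, B u u = 2 * n) :
    ∀ u ∈ Submodule.span ℤ S, ∃ n : ℤ, B u u = 2 * n := by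
  intro u hu
  induction hu using Submodule.span_induction with
  | mem x hx => exact h' x hx
  | zero => exact ⟨0, by simp [B]⟩
  | add x y hx hy ihx ihy =>
    obtain ⟨a, ha⟩ := ihx
    obtain ⟨b, hb⟩ := ihy
    obtain ⟨c, hc⟩ := exists_int_B_of_mem_span h x hx y hy
    refine ⟨a + b + c, ?_⟩
    rw [B_add_left, B_comm x, B_comm y, B_add_left, B_add_left, B_comm y x, ha, hb, hc]
    push_cast
    ring
  | smul n x _ ihx =>
    obtain ⟨a, ha⟩ := ihx
    refine ⟨n * n * a, ?_⟩
    rw [B_smul_left, B_comm, B_smul_left, ha]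
    push_cast
    ring

theorem exists_int_B_bv {v : V} (hv : ∀ j, ∃ m : ℤ, 2 * v j = m) (i : Fin 12) :
    ∃ n : ℤ, B (bv i) v = n := by
  choose m hm using hv
  have hv' : v = fun j => (m j : ℚ) / 2 := by
    ext j
    rw [← hm j]
    ring
  refine ⟨∑ j, (if i.val < 4 ∧ j.val < 4 then
    (if i = j then -2 else if i.val = 2 ∨ j.val = 2 then 1 else 0)
    else if i = j then -1 else 0) * m j, ?_⟩
  rw [B_bv_left, mulVec, dotProduct]
  push_cast
  refine Finset.sum_congr rfl fun j _ => ?_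
  simp only [gramG, Matrix.of_apply, hv']
  split_ifs <;> ring

theorem B_bv_self (i : Fin 12) : ∃ n : ℤ, B (bv i) (bv i) = 2 * n := by
  by_cases hi : i.val < 4
  · exact ⟨-2, by fin_cases i <;> simp_all [B_apply, bv] <;> norm_num⟩
  · exact ⟨-1, by fin_cases i <;> simp_all [B_apply, bv]⟩

theorem two_mul_bv (i j : Fin 12) : ∃ m : ℤ, 2 * bv i j = m :=
  ⟨if i = j then 2 else 0, by simp [bv]⟩

theorem two_mul_half_sum {w : V} (hw : ∀ j, ∃ m : ℤ, w j = m) (j : Fin 12) :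
    ∃ m : ℤ, 2 * ((1 / 2 : ℚ) • w) j = m := by
  obtain ⟨m, hm⟩ := hw j
  exact ⟨m, by simp [hm]⟩

theorem two_mul_glue {v : V} (hv : v ∈ ({ν, x₁, x₂} : Set V)) (j : Fin 12) :
    ∃ m : ℤ, 2 * v j = m := by
  have hb (i j : Fin 12) : bv i j = ((if i = j then 1 else 0 : ℤ) : ℚ) := by simp [bv]
  rcases hv with rfl | rfl | rfl <;> refine two_mul_half_sum (fun j => ?_) j <;>
    simp only [Pi.add_apply, Pi.sub_apply, hb, ← Int.cast_add, ← Int.cast_sub, Int.cast_inj,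
      exists_eq']

theorem exists_int_B_glue : ∀ u ∈ ({ν, x₁, x₂} : Set V), ∀ v ∈ ({ν, x₁, x₂} : Set V),
    ∃ n : ℤ, B u v = 2 * n := by
  have hνν : B ν ν = 2 * (-2 : ℤ) := by simp [B_apply, ν, bv]; norm_num
  have hν1 : B ν x₁ = 2 * (-1 : ℤ) := by simp [B_apply, ν, x₁, bv]; norm_num
  have hν2 : B ν x₂ = 2 * (-1 : ℤ) := by simp [B_apply, ν, x₂, bv]; norm_num
  have h11 : B x₁ x₁ = 2 * (-2 : ℤ) := by simp [B_apply, x₁, bv]; norm_num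
  have h12 : B x₁ x₂ = 2 * (-1 : ℤ) := by simp [B_apply, x₁, x₂, bv]; norm_num
  have h22 : B x₂ x₂ = 2 * (-2 : ℤ) := by simp [B_apply, x₂, bv]; norm_num
  rintro u (rfl | rfl | rfl) v (rfl | rfl | rfl)
  exacts [⟨_, hνν⟩, ⟨_, hν1⟩, ⟨_, hν2⟩, ⟨_, B_comm _ _ ▸ hν1⟩, ⟨_, h11⟩, ⟨_, h12⟩,
    ⟨_, B_comm _ _ ▸ hν2⟩, ⟨_, B_comm _ _ ▸ h12⟩, ⟨_, h22⟩]

theorem exists_int_B_generators : ∀ u ∈ Set.range bv ∪ {ν, x₁, x₂},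
    ∀ v ∈ Set.range bv ∪ {ν, x₁, x₂}, ∃ n : ℤ, B u v = n := by
  rintro u (⟨i, rfl⟩ | hu) v (⟨k, rfl⟩ | hv)
  · exact exists_int_B_bv (two_mul_bv k) i
  · exact exists_int_B_bv (two_mul_glue hv) i
  · rw [B_comm]
    exact exists_int_B_bv (two_mul_glue hu) k
  · obtain ⟨n, hn⟩ := exists_int_B_glue u hu v hv
    exact ⟨2 * n, by rw [hn]; push_cast; rfl⟩

theorem exists_even_B_self_generators : ∀ u ∈ Set.range bv ∪ {ν, x₁, x₂},
    ∃ n : ℤ, B u u = 2 * n := by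
  rintro u (⟨i, rfl⟩ | hu)
  · exact B_bv_self i
  · exact exists_int_B_glue u hu u hu

/-- The permutation of the coordinates fixing every `e_i` and sending
`n₂, n₃, n₄, n₅, n₆, n₇, n₈` to `n₃, n₂, n₆, n₈, n₇, n₄, n₅`. -/
def coordPerm : Equiv.Perm (Fin 12) where
  toFun := ![0, 1, 2, 3, 4, 6, 5, 9, 11, 10, 7, 8]
  invFun := ![0, 1, 2, 3, 4, 6, 5, 10, 11, 7, 9, 8]
  left_inv := by decide
  right_inv := by decide

/-- The automorphism of `V` permuting the standard basis by `coordPerm`. -/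
def permV : V ≃ₗ[ℤ] V := LinearEquiv.funCongrLeft ℤ ℚ coordPerm.symm

theorem permV_apply (v : V) (j : Fin 12) : permV v j = v (coordPerm.symm j) := rfl

theorem permV_bv (i : Fin 12) : permV (bv i) = bv (coordPerm i) := by
  ext j
  simp [permV_apply, bv, Equiv.eq_symm_apply]

theorem B_permV (u v : V) : B (permV u) (permV v) = B u v := by
  simp [B_apply, permV_apply, coordPerm]
  ring

theorem permV_half (w : V) : permV ((1 / 2 : ℚ) • w) = (1 / 2 : ℚ) • permV w := rfl

theorem permV_ν : permV ν = ν := by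
  simp only [ν, permV_half, map_add, permV_bv]
  simp [coordPerm]
  abel

theorem permV_x₁ : permV x₁ = x'₂ - bv 1 := by
  simp only [x₁, x'₂, permV_half, map_add, map_sub, permV_bv]
  simp [coordPerm]
  module

theorem permV_x₂ : permV x₂ = x'₁ + bv 0 - bv 1 := by
  simp only [x₂, x'₁, permV_half, map_add, map_sub, permV_bv]
  simp [coordPerm]
  module

theorem map_permV_Γτ : Γτ.map (permV : V →ₗ[ℤ] V) = Γφ := by
  have hb (i : Fin 12) : bv i ∈ Γφ := Submodule.subset_span (Or.inl ⟨i, rfl⟩)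
  have hbv (i : Fin 12) : bv i ∈ Γτ.map (permV : V →ₗ[ℤ] V) :=
    ⟨bv (coordPerm.symm i), Submodule.subset_span (Or.inl ⟨_, rfl⟩), by simp [permV_bv]⟩
  have hν : ν ∈ Γφ := Submodule.subset_span (by simp)
  have h1 : x'₁ ∈ Γφ := Submodule.subset_span (by simp)
  have h2 : x'₂ ∈ Γφ := Submodule.subset_span (by simp)
  have hν' : permV ν ∈ Γτ.map (permV : V →ₗ[ℤ] V) :=
    ⟨ν, Submodule.subset_span (by simp), rfl⟩
  have hx₁ : permV x₁ ∈ Γτ.map (permV : V →ₗ[ℤ] V) :=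
    ⟨x₁, Submodule.subset_span (by simp), rfl⟩
  have hx₂ : permV x₂ ∈ Γτ.map (permV : V →ₗ[ℤ] V) :=
    ⟨x₂, Submodule.subset_span (by simp), rfl⟩
  apply le_antisymm
  · rw [Γτ, Submodule.map_span_le]
    rintro u (⟨i, rfl⟩ | rfl | rfl | rfl)
    · exact (permV_bv i).symm ▸ hb _
    · exact permV_ν.symm ▸ hν
    · exact permV_x₁.symm ▸ sub_mem h2 (hb 1)
    · exact permV_x₂.symm ▸ sub_mem (add_mem h1 (hb 0)) (hb 1)
  · rw [Γφ, Submodule.span_le]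
    rintro u (⟨i, rfl⟩ | rfl | rfl | rfl)
    · exact hbv i
    · exact permV_ν ▸ hν'
    · have h : x'₁ = permV x₂ - bv 0 + bv 1 := by rw [permV_x₂]; abel
      exact h ▸ add_mem (sub_mem hx₂ (hbv 0)) (hbv 1)
    · have h : x'₂ = permV x₁ + bv 1 := by rw [permV_x₁]; abel
      exact h ▸ add_mem hx₁ (hbv 1)

/-- Γ_τ and Γ_φ are even lattices and they are isometric. -/
theorem stmt8 :
    (∀ u ∈ Γτ, ∀ v ∈ Γτ, ∃ n : ℤ, B u v = (n : ℚ)) ∧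
    (∀ u ∈ Γτ, ∃ n : ℤ, B u u = 2 * (n : ℚ)) ∧
    (∀ u ∈ Γφ, ∀ v ∈ Γφ, ∃ n : ℤ, B u v = (n : ℚ)) ∧
    (∀ u ∈ Γφ, ∃ n : ℤ, B u u = 2 * (n : ℚ)) ∧
    (∃ F : Γτ ≃ₗ[ℤ] Γφ, ∀ u v : Γτ, B (F u : V) (F v : V) = B (u : V) (v : V)) := by
  have hpair := exists_int_B_of_mem_span exists_int_B_generators
  have heven := exists_even_B_self_of_mem_span exists_int_B_generators
    exists_even_B_self_generators
  refine ⟨hpair, heven, ?_, ?_, ?_⟩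
  · rw [← map_permV_Γτ]
    rintro _ ⟨u, hu, rfl⟩ _ ⟨v, hv, rfl⟩
    obtain ⟨n, hn⟩ := hpair u hu v hv
    exact ⟨n, (B_permV u v).trans hn⟩
  · rw [← map_permV_Γτ]
    rintro _ ⟨u, hu, rfl⟩
    obtain ⟨n, hn⟩ := heven u hu
    exact ⟨n, (B_permV u u).trans hn⟩
  · exact ⟨(permV.submoduleMap Γτ).trans (LinearEquiv.ofEq _ _ map_permV_Γτ),
      fun u v => B_permV u v⟩
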